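/- Let p ∈ ℝ and let f : ℝ × ℝ → ℝ be smooth with compact support contained in ℝ × (0,∞). Then for every k ∈ ℝ with k ≠ 0 and every θ ∈ (0, π/2), the two-dimensional Fourier slice identity holds in cosine form: ∫_0^∞ cos(y·|k|·tan(θ)) · y^{-p} · (F f)(k, y) dy = (1/2) · cos(θ)^{1−p} · (F R^(p) f)(k, θ). -/

import Mathlib

open MeasureTheory Real

noncomputable section

/-- The two-dimensional conical Radon transform with radial weight `1/s^p`:
`(R^(p) f)(u, θ) = ∫_0^∞ s^(-p) [f(u + s sin θ, s cos θ) + f(u - s sin θ, s cos θ)] ds`. -/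
def coneRadon2 (p : ℝ) (f : ℝ × ℝ → ℝ) (u θ : ℝ) : ℝ :=
  ∫ s in Set.Ioi (0 : ℝ),
    s ^ (-p) *
      (f (u + s * Real.sin θ, s * Real.cos θ) + f (u - s * Real.sin θ, s * Real.cos θ))

/-- Fourier transform in the first argument: `(F g)(k, θ) = ∫_ℝ e^{-iku} g(u, θ) du`. -/
def fourierFirst2 (g : ℝ → ℝ → ℝ) (k θ : ℝ) : ℂ :=
  ∫ u : ℝ, Complex.exp (-Complex.I * (k * u : ℝ)) * (g u θ : ℂ)

/-- The filtered data `g(u, θ) = (1/(2π)) ∫_ℝ |k| (F R^(p) f)(k, θ) e^{iku} dk`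
(equal to `∂_u H_u R^(p) f`). -/
def filteredData2 (p : ℝ) (f : ℝ × ℝ → ℝ) (u θ : ℝ) : ℂ :=
  ((1 / (2 * π) : ℝ) : ℂ) *
    ∫ k : ℝ, ((|k| : ℝ) : ℂ) * fourierFirst2 (coneRadon2 p f) k θ *
      Complex.exp (Complex.I * (k * u : ℝ))

/-- The shear `(u, s) ↦ (u + s a, s c)` of the plane, for `c ≠ 0`. -/
def shearHomeomorph (a c : ℝ) (hc : c ≠ 0) : ℝ × ℝ ≃ₜ ℝ × ℝ where
  toFun q := (q.1 + q.2 * a, q.2 * c)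
  invFun q := (q.1 - q.2 / c * a, q.2 / c)
  left_inv q := by ext <;> simp [hc]
  right_inv q := by ext <;> simp [hc]
  continuous_toFun := by fun_prop
  continuous_invFun := by fun_prop

lemma continuous_rpow_mul_comp_shear (p : ℝ) {f : ℝ × ℝ → ℝ} (hf : Continuous f)
    (hfs : tsupport f ⊆ {q : ℝ × ℝ | 0 < q.2}) (a : ℝ) {c : ℝ} (hc : 0 < c) :
    Continuous fun q : ℝ × ℝ => q.2 ^ (-p) * f (q.1 + q.2 * a, q.2 * c) := by
  refine continuous_of_tsupport fun q hq => ?_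
  have hq' := tsupport_comp_subset_preimage f (shearHomeomorph a c hc.ne').continuous
    (tsupport_mul_subset_right hq)
  have hpos : 0 < q.2 * c := hfs hq'
  have hq2 : 0 < q.2 := (pos_iff_pos_of_mul_pos hpos).2 hc
  exact (continuousAt_snd.rpow_const (Or.inl hq2.ne')).mul (by fun_prop)

lemma hasCompactSupport_rpow_mul_comp_shear (p : ℝ) {f : ℝ × ℝ → ℝ}
    (hfc : HasCompactSupport f) (a : ℝ) {c : ℝ} (hc : c ≠ 0) :
    HasCompactSupport fun q : ℝ × ℝ => q.2 ^ (-p) * f (q.1 + q.2 * a, q.2 * c) :=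
  (hfc.comp_homeomorph (shearHomeomorph a c hc)).mul_left

lemma integrable_exp_mul_horizontal_slice {f : ℝ × ℝ → ℝ} (hf : Continuous f)
    (hfc : HasCompactSupport f) (k y : ℝ) :
    Integrable fun u : ℝ => Complex.exp (-Complex.I * (k * u : ℝ)) * (f (u, y) : ℂ) := by
  have hsupp : HasCompactSupport fun u : ℝ => f (u, y) :=
    hfc.comp_isClosedEmbedding
      (.of_continuous_injective_isClosedMap (by fun_prop) (Prod.mk_left_injective y)
        (isClosedMap_prodMk_right y))
  refine Continuous.integrable_of_hasCompactSupport (by fun_prop) ?_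
  exact (hsupp.comp_left (g := ((↑) : ℝ → ℂ)) Complex.ofReal_zero).mul_left

lemma exp_mul_shift_eq (f : ℝ × ℝ → ℝ) (k y b u : ℝ) :
    Complex.exp (-Complex.I * (k * u : ℝ)) * (f (u + b, y) : ℂ) =
      Complex.exp (Complex.I * (k * b : ℝ)) *
        (Complex.exp (-Complex.I * (k * (u + b) : ℝ)) * (f (u + b, y) : ℂ)) := by
  rw [← mul_assoc, ← Complex.exp_add]
  congr 2
  push_cast
  ring

/-- Translation in the first variable multiplies the Fourier transform by a phase. -/
lemma fourierFirst2_shift (f : ℝ × ℝ → ℝ) (k y b : ℝ) :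
    fourierFirst2 (fun u y => f (u + b, y)) k y =
      Complex.exp (Complex.I * (k * b : ℝ)) * fourierFirst2 (fun u y => f (u, y)) k y := by
  simp only [fourierFirst2, exp_mul_shift_eq f k y b]
  rw [integral_const_mul, integral_add_right_eq_self
    (fun u : ℝ => Complex.exp (-Complex.I * (k * u : ℝ)) * (f (u, y) : ℂ))]

lemma integral_exp_mul_add_shifts {f : ℝ × ℝ → ℝ} (hf : Continuous f)
    (hfc : HasCompactSupport f) (k y b : ℝ) :
    ∫ u : ℝ, Complex.exp (-Complex.I * (k * u : ℝ)) * ((f (u + b, y) + f (u - b, y) : ℝ) : ℂ) =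
      ((2 * Real.cos (k * b) : ℝ) : ℂ) * fourierFirst2 (fun u y => f (u, y)) k y := by
  have hint (b : ℝ) : Integrable fun u : ℝ =>
      Complex.exp (-Complex.I * (k * u : ℝ)) * (f (u + b, y) : ℂ) := by
    simp only [exp_mul_shift_eq f k y b]
    exact ((integrable_exp_mul_horizontal_slice hf hfc k y).comp_add_right b).const_mul _
  have h₁ := fourierFirst2_shift f k y b
  have h₂ := fourierFirst2_shift f k y (-b)
  simp only [Complex.ofReal_add, mul_add, sub_eq_add_neg]
  rw [integral_add (hint b) (hint (-b))]
  refine (congrArg₂ (· + ·) h₁ h₂).trans ?_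
  rw [← add_mul]
  congr 1
  push_cast
  rw [Complex.two_cos]
  congr 2 <;> ring

/-- The Fourier transform of the conical Radon transform as a weighted radial integral. -/
lemma fourierFirst2_coneRadon2 (p : ℝ) {f : ℝ × ℝ → ℝ} (hf : Continuous f)
    (hfc : HasCompactSupport f) (hfs : tsupport f ⊆ {q : ℝ × ℝ | 0 < q.2}) (k : ℝ) {θ : ℝ}
    (hc : 0 < Real.cos θ) :
    fourierFirst2 (coneRadon2 p f) k θ =
      ∫ s in Set.Ioi (0 : ℝ), ((s ^ (-p) * (2 * Real.cos (k * (s * Real.sin θ))) : ℝ) : ℂ) *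
        fourierFirst2 (fun u y => f (u, y)) k (s * Real.cos θ) := by
  let G : ℝ → ℝ → ℝ := fun u s => s ^ (-p) *
    (f (u + s * Real.sin θ, s * Real.cos θ) + f (u - s * Real.sin θ, s * Real.cos θ))
  have hG : Function.uncurry G = fun q : ℝ × ℝ =>
      q.2 ^ (-p) * f (q.1 + q.2 * Real.sin θ, q.2 * Real.cos θ) +
        q.2 ^ (-p) * f (q.1 + q.2 * -Real.sin θ, q.2 * Real.cos θ) := by
    ext ⟨u, s⟩
    simp only [Function.uncurry, G, mul_neg, sub_eq_add_neg, mul_add]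
  have hGcont : Continuous (Function.uncurry G) := by
    rw [hG]
    exact (continuous_rpow_mul_comp_shear p hf hfs _ hc).add
      (continuous_rpow_mul_comp_shear p hf hfs _ hc)
  have hGsupp : HasCompactSupport (Function.uncurry G) := by
    rw [hG]
    exact (hasCompactSupport_rpow_mul_comp_shear p hfc _ hc.ne').add
      (hasCompactSupport_rpow_mul_comp_shear p hfc _ hc.ne')
  let H : ℝ → ℝ → ℂ := fun u s => Complex.exp (-Complex.I * (k * u : ℝ)) * (G u s : ℂ)
  have hHcont : Continuous (Function.uncurry H) :=
    (by fun_prop : Continuous fun q : ℝ × ℝ => Complex.exp (-Complex.I * (k * q.1 : ℝ))).mul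
      (Complex.continuous_ofReal.comp hGcont)
  have hHsupp : HasCompactSupport (Function.uncurry H) :=
    (hGsupp.comp_left (g := ((↑) : ℝ → ℂ)) Complex.ofReal_zero).mul_left
  calc
    fourierFirst2 (coneRadon2 p f) k θ = ∫ u : ℝ, ∫ s in Set.Ioi (0 : ℝ), H u s := by
      refine integral_congr_ae (.of_forall fun u => ?_)
      simp only [H, G, coneRadon2]
      rw [integral_const_mul, integral_complex_ofReal]
    _ = ∫ s in Set.Ioi (0 : ℝ), ∫ u : ℝ, H u s :=
      integral_integral_swap_of_hasCompactSupport hHcont hHsupp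
    _ = _ := by
      refine integral_congr_ae (.of_forall fun s => ?_)
      simp only [H, G]
      rw [Complex.ofReal_mul, mul_assoc, ← integral_exp_mul_add_shifts hf hfc,
        ← integral_const_mul]
      refine integral_congr_ae (.of_forall fun u => ?_)
      simp only [Complex.ofReal_mul]
      ring

/-- two-dimensional Fourier slice identity in cosine form:
`∫_0^∞ cos(y |k| tan θ) y^{-p} (F f)(k, y) dy = (1/2) cos θ^{1-p} (F R^(p) f)(k, θ)`. -/
theorem coneRadon2_fourier_slice (p : ℝ) (f : ℝ × ℝ → ℝ)
    (hf : ContDiff ℝ (⊤ : ℕ∞) f) (hfc : HasCompactSupport f)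
    (hfs : tsupport f ⊆ {q : ℝ × ℝ | 0 < q.2})
    (k : ℝ) (hk : k ≠ 0) (θ : ℝ) (hθ : θ ∈ Set.Ioo (0 : ℝ) (π / 2)) :
    ∫ y in Set.Ioi (0 : ℝ),
        ((Real.cos (y * |k| * Real.tan θ) * y ^ (-p) : ℝ) : ℂ) *
          fourierFirst2 (fun u y => f (u, y)) k y =
      ((1 / 2 * Real.cos θ ^ (1 - p) : ℝ) : ℂ) * fourierFirst2 (coneRadon2 p f) k θ := by
  have hc : 0 < Real.cos θ := Real.cos_pos_of_mem_Ioo ⟨by linarith [hθ.1, hθ.2], hθ.2⟩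
  rw [fourierFirst2_coneRadon2 p hf.continuous hfc hfs k hc]
  have hsub := integral_comp_mul_right_Ioi (fun y : ℝ =>
    ((Real.cos (y * |k| * Real.tan θ) * y ^ (-p) : ℝ) : ℂ) *
      fourierFirst2 (fun u y => f (u, y)) k y) 0 hc
  rw [zero_mul, eq_inv_smul_iff₀ hc.ne'] at hsub
  rw [← hsub, ← integral_smul, ← integral_const_mul]
  refine setIntegral_congr_fun measurableSet_Ioi fun s hs => ?_
  have hs : 0 < s := hs
  have hcos : Real.cos (s * Real.cos θ * |k| * Real.tan θ) =
      Real.cos (k * (s * Real.sin θ)) := by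
    rw [show s * Real.cos θ * |k| * Real.tan θ = |k| * (s * Real.sin θ) by
      rw [← Real.tan_mul_cos hc.ne']; ring]
    rcases abs_choice k with h | h <;> simp [h]
  have hpow : Real.cos θ ^ (1 - p) = Real.cos θ * Real.cos θ ^ (-p) := by
    rw [sub_eq_add_neg, Real.rpow_add hc, Real.rpow_one]
  simp only [hcos, Real.mul_rpow hs.le hc.le, hpow, Complex.real_smul]
  push_cast
  ring
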